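/- A symmetric matrix X ∈ 𝕊ⁿ is scaled diagonally dominant if and only if it admits a factorization X = V Vᵀ for some matrix V each of whose columns has at most 2 nonzero entries. -/

import Mathlib

open Matrix Finset

/-- A symmetric matrix with nonpositive off-diagonal entries and nonnegative quadratic form maps
some strictly positive vector to a nonnegative one. -/
theorem exists_pos_mulVec_nonneg (n : ℕ) (M : Matrix (Fin n) (Fin n) ℝ) (hM : M.IsSymm)
    (hoff : ∀ i j, i ≠ j → M i j ≤ 0) (hpsd : ∀ x : Fin n → ℝ, 0 ≤ ∑ i, ∑ j, x i * M i j * x j) :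
    ∃ d : Fin n → ℝ, (∀ i, 0 < d i) ∧ ∀ i, 0 ≤ ∑ j, M i j * d j := by
  induction n with
  | zero => exact ⟨0, fun i => i.elim0, fun i => i.elim0⟩
  | succ n ih =>
    have hrow : ∀ j : Fin n, M 0 j.succ ≤ 0 := fun j => hoff _ _ (Fin.succ_ne_zero j).symm
    have hsymm : ∀ j : Fin n, M j.succ 0 = M 0 j.succ := fun j => hM.apply _ _
    have hquad : ∀ (t : ℝ) (x : Fin n → ℝ), 0 ≤ t ^ 2 * M 0 0
        + 2 * t * ∑ j, M 0 j.succ * x j + ∑ i, ∑ j, x i * M i.succ j.succ * x j := by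
      intro t x
      have h := hpsd (Fin.cons t x)
      simp only [Fin.sum_univ_succ, Fin.cons_zero, Fin.cons_succ, sum_add_distrib, hsymm] at h
      have e₁ : ∑ j, t * M 0 j.succ * x j = t * ∑ j, M 0 j.succ * x j := by
        rw [mul_sum]; exact sum_congr rfl fun j _ => by ring
      have e₂ : ∑ j, x j * M 0 j.succ * t = t * ∑ j, M 0 j.succ * x j := by
        rw [mul_sum]; exact sum_congr rfl fun j _ => by ring
      rw [e₁, e₂] at h
      linarith
    have h00 : 0 ≤ M 0 0 := by simpa using hquad 1 0
    -- If the first row vanishes off the diagonal, the first coordinate decouples.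
    have decoupled (hz : ∀ j : Fin n, M 0 j.succ = 0) :
        ∃ d : Fin (n + 1) → ℝ, (∀ i, 0 < d i) ∧ ∀ i, 0 ≤ ∑ j, M i j * d j := by
      obtain ⟨d, hd, h⟩ := ih (M.submatrix Fin.succ Fin.succ) (hM.submatrix _)
        (fun i j hij => hoff _ _ fun h => hij (Fin.succ_injective _ h))
        (fun x => by simpa using hquad 0 x)
      refine ⟨Fin.cons 1 d, Fin.cases (by simp) (by simpa using hd), Fin.cases ?_ fun i => ?_⟩
      · simpa [Fin.sum_univ_succ, hz] using h00
      · simpa [Fin.sum_univ_succ, hz, hsymm] using h i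
    rcases h00.eq_or_lt with h0 | hpos
    · refine decoupled fun j => ?_
      by_contra hne
      have h := hquad (-(M j.succ j.succ + 1) / (2 * M 0 j.succ)) (Pi.single j 1)
      simp [Pi.single_apply, ← h0] at h
      field_simp at h
      linarith
    · by_cases hz : ∀ j : Fin n, M 0 j.succ = 0
      · exact decoupled hz
      -- Otherwise pass to the Schur complement of the first diagonal entry.
      obtain ⟨d, hd, h⟩ := ih
        (Matrix.of fun i j => M i.succ j.succ - M 0 i.succ * M 0 j.succ / M 0 0)
        (by ext i j; simp [hM.apply i.succ j.succ, mul_comm])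
        (fun i j hij => by
          have h₁ := hoff i.succ j.succ fun h => hij (Fin.succ_injective _ h)
          have h₂ : 0 ≤ M 0 i.succ * M 0 j.succ / M 0 0 :=
            div_nonneg (mul_nonneg_of_nonpos_of_nonpos (hrow i) (hrow j)) h00
          simp only [Matrix.of_apply]
          linarith)
        (fun x => by
          have h := hquad (-(∑ j, M 0 j.succ * x j) / M 0 0) x
          have e : ∑ i, ∑ j, x i * (M i.succ j.succ - M 0 i.succ * M 0 j.succ / M 0 0) * x j
              = ∑ i, ∑ j, x i * M i.succ j.succ * x j
                - (∑ j, M 0 j.succ * x j) * (∑ j, M 0 j.succ * x j) / M 0 0 := by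
            rw [sum_mul_sum, sum_div, ← sum_sub_distrib]
            refine sum_congr rfl fun i _ => ?_
            rw [sum_div, ← sum_sub_distrib]
            exact sum_congr rfl fun j _ => by ring
          simp only [Matrix.of_apply]
          rw [e]
          convert h using 1
          field_simp
          ring)
      push Not at hz
      obtain ⟨k, hk⟩ := hz
      have hneg : ∑ j, M 0 j.succ * d j < 0 :=
        sum_neg' (fun j _ => mul_nonpos_of_nonpos_of_nonneg (hrow j) (hd j).le)
          ⟨k, mem_univ k, mul_neg_of_neg_of_pos (lt_of_le_of_ne (hrow k) hk) (hd k)⟩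
      refine ⟨Fin.cons (-(∑ j, M 0 j.succ * d j) / M 0 0) d,
        Fin.cases ?_ (by simpa using hd), Fin.cases ?_ fun i => ?_⟩
      · exact div_pos (neg_pos.2 hneg) hpos
      · simp only [Fin.sum_univ_succ, Fin.cons_zero, Fin.cons_succ]
        rw [mul_div_cancel₀ _ hpos.ne', neg_add_cancel]
      · have h := h i
        simp only [Fin.sum_univ_succ, Fin.cons_zero, Fin.cons_succ, hsymm]
        simp only [Matrix.of_apply, sub_mul, sum_sub_distrib] at h
        have e : ∑ j, M 0 i.succ * M 0 j.succ / M 0 0 * d j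
            = M 0 i.succ * (∑ j, M 0 j.succ * d j) / M 0 0 := by
          rw [mul_sum, sum_div]; exact sum_congr rfl fun j _ => by ring
        rw [e] at h
        convert h using 1
        ring

/-- A vector with at most two nonzero entries satisfies `(∑ a)² ≤ 2 ∑ a²`. -/
theorem sq_sum_le_two_mul_sum_sq {ι : Type*} [Fintype ι] (a : ι → ℝ)
    (ha : (univ.filter fun i => a i ≠ 0).card ≤ 2) : (∑ i, a i) ^ 2 ≤ 2 * ∑ i, a i ^ 2 := by
  rw [← sum_filter_ne_zero]
  calc (∑ i ∈ univ.filter fun i => a i ≠ 0, a i) ^ 2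
      ≤ (univ.filter fun i => a i ≠ 0).card * ∑ i ∈ univ.filter fun i => a i ≠ 0, a i ^ 2 :=
        sq_sum_le_card_mul_sum_sq
    _ ≤ 2 * ∑ i, a i ^ 2 := by
        gcongr
        · exact_mod_cast ha
        · exact subset_univ _

/-- The comparison matrix of `V * Vᵀ` has a nonnegative quadratic form if every column of `V`
has at most two nonzero entries. -/
theorem comparison_quadratic_form_nonneg {ι κ : Type*} [Fintype ι] [DecidableEq ι] [Fintype κ]
    (V : Matrix ι κ ℝ) (hV : ∀ k, (univ.filter fun i => V i k ≠ 0).card ≤ 2) (x : ι → ℝ) :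
    0 ≤ ∑ i, ∑ j, x i * (if i = j then (V * Vᵀ) i j else -|(V * Vᵀ) i j|) * x j := by
  have hcol : ∀ k, 0 ≤ 2 * ∑ i, |V i k * x i| ^ 2 - (∑ i, |V i k * x i|) ^ 2 := fun k =>
    sub_nonneg.2 <| sq_sum_le_two_mul_sum_sq _ <| (card_le_card fun i => by
      simp only [mem_filter, mem_univ, true_and, ne_eq, abs_eq_zero, mul_eq_zero]
      tauto).trans (hV k)
  refine (sum_nonneg (s := univ) fun k _ => hcol k).trans ?_
  have e : ∑ k, (2 * ∑ i, |V i k * x i| ^ 2 - (∑ i, |V i k * x i|) ^ 2)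
      = ∑ i, ∑ j, ∑ k, ((if i = j then 2 * |V i k * x i| ^ 2 else 0)
        - |V i k * x i| * |V j k * x j|) := by
    rw [sum_congr rfl fun i _ => sum_comm, sum_comm]
    refine sum_congr rfl fun k _ => ?_
    rw [sq (∑ i, |V i k * x i|), sum_mul_sum]
    simp [sum_sub_distrib, mul_sum]
  rw [e]
  refine sum_le_sum fun i _ => sum_le_sum fun j _ => ?_
  simp only [Matrix.mul_apply, Matrix.transpose_apply]
  split_ifs with hij
  · subst hij
    rw [mul_sum, sum_mul]
    refine sum_le_sum fun k _ => ?_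
    rw [abs_mul_abs_self, sq_abs]
    exact le_of_eq (by ring)
  · have h₁ : |∑ k, V i k * V j k| ≤ ∑ k, |V i k| * |V j k| :=
      (abs_sum_le_sum_abs _ _).trans_eq (sum_congr rfl fun k _ => abs_mul _ _)
    have h₂ : x i * |∑ k, V i k * V j k| * x j ≤ (∑ k, |V i k| * |V j k|) * (|x i| * |x j|) :=
      calc x i * |∑ k, V i k * V j k| * x j
          = |∑ k, V i k * V j k| * (x i * x j) := by ring
        _ ≤ |∑ k, V i k * V j k| * (|x i| * |x j|) := by
          refine mul_le_mul_of_nonneg_left ?_ (abs_nonneg _)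
          rw [← abs_mul]
          exact le_abs_self _
        _ ≤ _ := by gcongr
    have e₂ : ∑ k, (0 - |V i k * x i| * |V j k * x j|)
        = -((∑ k, |V i k| * |V j k|) * (|x i| * |x j|)) := by
      rw [sum_mul, ← sum_neg_distrib]
      exact sum_congr rfl fun k _ => by rw [abs_mul, abs_mul]; ring
    rw [e₂]
    linarith

/-- The matrix whose column `(p, q)` is `a p q • e p + b p q • e q`. -/
def pairColumns {ι : Type*} [DecidableEq ι] (a b : ι → ι → ℝ) : Matrix ι (ι × ι) ℝ :=
  Matrix.of fun i k => (if i = k.1 then a k.1 k.2 else 0) + if i = k.2 then b k.1 k.2 else 0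

theorem pairColumns_card_le {ι : Type*} [Fintype ι] [DecidableEq ι] (a b : ι → ι → ℝ)
    (k : ι × ι) : (univ.filter fun i => pairColumns a b i k ≠ 0).card ≤ 2 := by
  refine (card_le_card (t := {k.1, k.2}) fun i hi => ?_).trans card_le_two
  by_contra h
  simp only [mem_insert, mem_singleton, not_or] at h
  exact (mem_filter.1 hi).2 (by simp [pairColumns, h.1, h.2])

theorem pairColumns_mul_transpose {ι : Type*} [Fintype ι] [DecidableEq ι] (a b : ι → ι → ℝ)
    (i j : ι) : (pairColumns a b * (pairColumns a b)ᵀ) i j =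
      (if i = j then ∑ k, (a i k ^ 2 + b k i ^ 2) else 0) + a i j * b i j + a j i * b j i := by
  simp only [Matrix.mul_apply, Matrix.transpose_apply, pairColumns, Matrix.of_apply,
    Fintype.sum_prod_type, add_mul, mul_add, sum_add_distrib, ite_mul, mul_ite, zero_mul, mul_zero,
    sum_ite_irrel, sum_ite_eq, sum_const_zero, mem_univ, if_true]
  by_cases hij : i = j
  · subst hij
    simp [sq]
    ring
  · simp [hij]
    ring

theorem scaled_diagonally_dominant_iff_factorization (n : ℕ)
    (X : Matrix (Fin n) (Fin n) ℝ) (hX : X.IsSymm) :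
    (∃ d : Fin n → ℝ, (∀ i, 0 < d i) ∧
      ∀ i, ∑ j ∈ Finset.univ.erase i, d j * |X i j| ≤ X i i * d i) ↔
    (∃ (N : ℕ) (V : Matrix (Fin n) (Fin N) ℝ), X = V * Vᵀ ∧
      ∀ j, (Finset.univ.filter fun i => V i j ≠ 0).card ≤ 2) := by
  constructor
  · rintro ⟨d, hd, h⟩
    let s : Fin n → Fin n → ℝ := fun p q => √(|X p q| * d q / (2 * d p))
    have hs : ∀ p q, s p q ^ 2 = |X p q| * d q / (2 * d p) := fun p q =>
      Real.sq_sqrt (div_nonneg (mul_nonneg (abs_nonneg _) (hd q).le) (by linarith [hd p]))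
    have hss : ∀ p q, s p q * s q p = |X p q| / 2 := fun p q => by
      have hp := hd p
      have hq := hd q
      rw [← Real.sqrt_mul (by positivity), hX.apply p q, Real.sqrt_eq_iff_mul_self_eq
        (by positivity) (by positivity)]
      field_simp
    let c : Fin n → ℝ := fun p => √(X p p - (∑ q ∈ univ.erase p, d q * |X p q|) / d p)
    have hc : ∀ p, c p ^ 2 = X p p - (∑ q ∈ univ.erase p, d q * |X p q|) / d p := fun p =>
      Real.sq_sqrt (sub_nonneg.2 ((div_le_iff₀ (hd p)).2 (h p)))
    let a : Fin n → Fin n → ℝ := fun p q => if p = q then c p else s p q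
    let b : Fin n → Fin n → ℝ := fun p q => if p = q then 0 else SignType.sign (X p q) * s q p
    have hab : ∀ p q, p ≠ q → a p q * b p q = X p q / 2 := fun p q hpq => by
      simp only [a, b, if_neg hpq]
      rw [mul_left_comm, hss, ← mul_div_assoc, sign_mul_abs]
    have hb : ∀ p q, p ≠ q → b p q ^ 2 = s q p ^ 2 := fun p q hpq => by
      simp only [b, if_neg hpq, mul_pow]
      rcases eq_or_ne (X p q) 0 with h0 | h0
      · simp [hs, hX.apply p q, h0]
      · rcases h0.lt_or_gt with h0 | h0 <;> simp [h0]
    have hfac : X = pairColumns a b * (pairColumns a b)ᵀ := by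
      ext i j
      rw [pairColumns_mul_transpose]
      by_cases hij : i = j
      · subst hij
        rw [if_pos rfl, ← add_sum_erase _ _ (mem_univ i),
          sum_congr (g := fun k => (d k * |X i k|) / d i) rfl fun k hk => by
            have hki := ne_of_mem_erase hk
            have hi := (hd i).ne'
            rw [hb k i hki]
            simp only [a, if_neg hki.symm, hs]
            field_simp
            norm_num,
          ← sum_div]
        simp [a, b, hc]
      · rw [if_neg hij, hab i j hij, hab j i (Ne.symm hij), hX.apply i j]
        ring
    let e := Fintype.equivFin (Fin n × Fin n)
    refine ⟨_, (pairColumns a b).submatrix id e.symm, ?_, fun j => pairColumns_card_le a b _⟩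
    rw [Matrix.transpose_submatrix, Matrix.submatrix_mul_equiv, ← hfac, Matrix.submatrix_id_id]
  · rintro ⟨N, V, rfl, hV⟩
    obtain ⟨d, hd, h⟩ := exists_pos_mulVec_nonneg n
      (Matrix.of fun i j => if i = j then (V * Vᵀ) i j else -|(V * Vᵀ) i j|)
      (by ext i j; simp [hX.apply i j, eq_comm (a := i)])
      (fun i j hij => by simp [hij])
      (comparison_quadratic_form_nonneg V hV)
    refine ⟨d, hd, fun i => ?_⟩
    have h := h i
    rw [← add_sum_erase _ _ (mem_univ i), sum_congr (g := fun j => -(d j * |(V * Vᵀ) i j|)) rfl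
      fun j hj => by simp [(ne_of_mem_erase hj).symm, mul_comm], sum_neg_distrib] at h
    simp only [Matrix.of_apply, if_true] at h
    linarith
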